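/- arXiv:2405.03617 — 2 statements merged into one kernel-verified Lean document; each statement's English description precedes it below -/
import Mathlib

section
/- Let a, A, H, B, G : ℝ × ℝ → ℝ with a continuously differentiable and nowhere zero, and define γ(x,t) = (A + a·G − (a_t + a·a_x))/(2a), evaluated at (x,t). Assume the structural condition γ_t + a·γ_x = H + G·γ − γ² holds at every point, and let α : ℝ × ℝ → ℝ be continuously differentiable with α_t + a·α_x = B + (G − γ)·α at every point. If u : ℝ × ℝ → ℝ is twice continuously differentiable and satisfies u_t(x,t) − a(x,t)·u_x(x,t) = γ(x,t)·u(x,t) + α(x,t) for all (x,t), then u satisfies the linear hyperbolic equation u_tt − a²·u_xx = A·u_x + H·u + B + G·u_t at every point (x,t). -/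
/-- Partial derivative of `v(x,t)` with respect to the first argument `x`. -/
noncomputable def px (v : ℝ × ℝ → ℝ) (p : ℝ × ℝ) : ℝ := fderiv ℝ v p (1, 0)

/-- Partial derivative of `v(x,t)` with respect to the second argument `t`. -/
noncomputable def pt (v : ℝ × ℝ → ℝ) (p : ℝ × ℝ) : ℝ := fderiv ℝ v p (0, 1)

theorem differentiable_fderiv_apply {u : ℝ × ℝ → ℝ} (hu : ContDiff ℝ 2 u) (v : ℝ × ℝ) :
    Differentiable ℝ fun q => fderiv ℝ u q v :=
  ((hu.fderiv_right (m := 1) one_add_one_eq_two.le).differentiable one_ne_zero).clm_apply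
    (differentiable_const v)

/-- Mixed partial derivatives of a `C^2` function commute. -/
theorem px_pt_comm {u : ℝ × ℝ → ℝ} (hu : ContDiff ℝ 2 u) (p : ℝ × ℝ) :
    px (pt u) p = pt (px u) p := by
  have hd : DifferentiableAt ℝ (fderiv ℝ u) p :=
    (hu.fderiv_right (m := 1) one_add_one_eq_two.le).differentiable one_ne_zero p
  have happly (v w : ℝ × ℝ) :
      fderiv ℝ (fun q => fderiv ℝ u q v) p w = fderiv ℝ (fderiv ℝ u) p w v := by
    simp [fderiv_clm_apply hd (differentiableAt_const v)]
  have hsymm := hu.contDiffAt.isSymmSndFDerivAt (x := p) (by simp)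
  exact (happly _ _).trans ((hsymm _ _).trans (happly _ _).symm)

/-- First intermediate integral for the linear hyperbolic equation
`u_tt − a²u_xx = Au_x + Hu + B + Gu_t`: with `γ = (A + aG − (a_t + aa_x))/(2a)`
satisfying `γ_t + aγ_x = H + Gγ − γ²`, and `α` with `α_t + aα_x = B + (G − γ)α`,
any `u` with `u_t − au_x = γu + α` solves the second order equation. -/
theorem linear_hyperbolic_first_intermediate_integral
    (a A H B G γ α : ℝ × ℝ → ℝ)
    (ha : ContDiff ℝ 1 a) (hane : ∀ p : ℝ × ℝ, a p ≠ 0)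
    (hγdef : ∀ p : ℝ × ℝ,
      γ p = (A p + a p * G p - (pt a p + a p * px a p)) / (2 * a p))
    (hγ : ContDiff ℝ 1 γ)
    (hstruct : ∀ p : ℝ × ℝ,
      pt γ p + a p * px γ p = H p + G p * γ p - (γ p)^2)
    (hα : ContDiff ℝ 1 α)
    (hαeq : ∀ p : ℝ × ℝ, pt α p + a p * px α p = B p + (G p - γ p) * α p)
    (u : ℝ × ℝ → ℝ) (hu : ContDiff ℝ 2 u)
    (heq : ∀ p : ℝ × ℝ, pt u p - a p * px u p = γ p * u p + α p) :
    ∀ p : ℝ × ℝ,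
      pt (pt u) p - (a p)^2 * px (px u) p =
        A p * px u p + H p * u p + B p + G p * pt u p := by
  intro p
  have hpt : Differentiable ℝ (pt u) := differentiable_fderiv_apply hu _
  have hpx : Differentiable ℝ (px u) := differentiable_fderiv_apply hu _
  have hda := ha.differentiable one_ne_zero
  have hdγ := hγ.differentiable one_ne_zero
  have hdα := hα.differentiable one_ne_zero
  have hdu := hu.differentiable two_ne_zero
  have hut : pt u = fun q => a q * px u q + (γ q * u q + α q) :=
    funext fun q => by linarith [heq q]
  have hderiv (v : ℝ × ℝ) : fderiv ℝ (pt u) p v =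
      a p * fderiv ℝ (px u) p v + px u p * fderiv ℝ a p v +
        (γ p * fderiv ℝ u p v + u p * fderiv ℝ γ p v + fderiv ℝ α p v) := by
    have h := ((hda p).hasFDerivAt.fun_mul (hpx p).hasFDerivAt).fun_add
      (((hdγ p).hasFDerivAt.fun_mul (hdu p).hasFDerivAt).fun_add (hdα p).hasFDerivAt)
    rw [← hut] at h
    simp [h.fderiv]
  have ht : pt (pt u) p = a p * pt (px u) p + px u p * pt a p +
      (γ p * pt u p + u p * pt γ p + pt α p) := hderiv (0, 1)
  have hx : px (pt u) p = a p * px (px u) p + px u p * px a p +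
      (γ p * px u p + u p * px γ p + px α p) := hderiv (1, 0)
  have hγp : γ p * (2 * a p) = A p + a p * G p - (pt a p + a p * px a p) :=
    (eq_div_iff (mul_ne_zero two_ne_zero (hane p))).mp (hγdef p)
  have hsymm := px_pt_comm hu p
  linear_combination ht + a p * hx - a p * hsymm + u p * hstruct p + hαeq p + px u p * hγp
    - (G p - γ p) * heq p
end

section
/- Let a, A, H, B, G : ℝ × ℝ → ℝ with a continuously differentiable and nowhere zero, and define η(x,t) = −(A − a·G + (a_t − a·a_x))/(2a), evaluated at (x,t). Assume the structural condition η_t − a·η_x = H + G·η − η² holds at every point, and let β : ℝ × ℝ → ℝ be continuously differentiable with β_t − a·β_x = B + (G − η)·β at every point. If u : ℝ × ℝ → ℝ is twice continuously differentiable and satisfies u_t(x,t) + a(x,t)·u_x(x,t) = η(x,t)·u(x,t) + β(x,t) for all (x,t), then u satisfies the linear hyperbolic equation u_tt − a²·u_xx = A·u_x + H·u + B + G·u_t at every point (x,t). -/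
theorem fderiv_apply_comm_of_contDiff {E : Type*} [NormedAddCommGroup E]
    [NormedSpace ℝ E] {u : E → ℝ} (hu : ContDiff ℝ 2 u)
    (p v w : E) :
    fderiv ℝ (fun q => fderiv ℝ u q v) p w = fderiv ℝ (fun q => fderiv ℝ u q w) p v := by
  have hd : DifferentiableAt ℝ (fderiv ℝ u) p :=
    (hu.fderiv_right (m := 1) (by norm_num)).differentiable (by norm_num) p
  have hsymm : IsSymmSndFDerivAt ℝ u p := hu.contDiffAt.isSymmSndFDerivAt (by simp)
  have happly (v w : E) :
      fderiv ℝ (fun q => fderiv ℝ u q v) p w = fderiv ℝ (fderiv ℝ u) p w v := by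
    simp [fderiv_clm_apply hd (differentiableAt_const v)]
  rw [happly, happly]
  exact hsymm w v

theorem contDiff_fderiv_apply_const {E : Type*} [NormedAddCommGroup E]
    [NormedSpace ℝ E] {u : E → ℝ} (hu : ContDiff ℝ 2 u) (v : E) :
    ContDiff ℝ 1 (fun q => fderiv ℝ u q v) :=
  (hu.fderiv_right (m := 1) (by norm_num)).clm_apply contDiff_const

theorem fderiv_add_mul_apply {E : Type*} [NormedAddCommGroup E]
    [NormedSpace ℝ E] {f g h : E → ℝ} {p : E}
    (hf : DifferentiableAt ℝ f p) (hg : DifferentiableAt ℝ g p)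
    (hh : DifferentiableAt ℝ h p) (v : E) :
    fderiv ℝ (fun q => f q + g q * h q) p v =
      fderiv ℝ f p v + (g p * fderiv ℝ h p v + h p * fderiv ℝ g p v) := by
  rw [fderiv_fun_add hf (hg.fun_mul hh), fderiv_fun_mul hg hh]
  simp

/-- Second intermediate integral for the linear hyperbolic equation
`u_tt − a²u_xx = Au_x + Hu + B + Gu_t`: with `η = −(A − aG + (a_t − aa_x))/(2a)`
satisfying `η_t − aη_x = H + Gη − η²`, and `β` with `β_t − aβ_x = B + (G − η)β`,
any `u` with `u_t + au_x = ηu + β` solves the second order equation. -/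
theorem linear_hyperbolic_second_intermediate_integral
    (a A H B G η β : ℝ × ℝ → ℝ)
    (ha : ContDiff ℝ 1 a) (hane : ∀ p : ℝ × ℝ, a p ≠ 0)
    (hηdef : ∀ p : ℝ × ℝ,
      η p = -(A p - a p * G p + (pt a p - a p * px a p)) / (2 * a p))
    (hη : ContDiff ℝ 1 η)
    (hstruct : ∀ p : ℝ × ℝ,
      pt η p - a p * px η p = H p + G p * η p - (η p)^2)
    (hβ : ContDiff ℝ 1 β)
    (hβeq : ∀ p : ℝ × ℝ, pt β p - a p * px β p = B p + (G p - η p) * β p)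
    (u : ℝ × ℝ → ℝ) (hu : ContDiff ℝ 2 u)
    (heq : ∀ p : ℝ × ℝ, pt u p + a p * px u p = η p * u p + β p) :
    ∀ p : ℝ × ℝ,
      pt (pt u) p - (a p)^2 * px (px u) p =
        A p * px u p + H p * u p + B p + G p * pt u p := by
  intro p
  have hda := ha.differentiable one_ne_zero p
  have hdη := hη.differentiable one_ne_zero p
  have hdβ := hβ.differentiable one_ne_zero p
  have hdu := hu.differentiable two_ne_zero p
  have hdx : DifferentiableAt ℝ (px u) p :=
    (contDiff_fderiv_apply_const hu (1, 0)).differentiable one_ne_zero p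
  have hdt : DifferentiableAt ℝ (pt u) p :=
    (contDiff_fderiv_apply_const hu (0, 1)).differentiable one_ne_zero p
  have hmixed : pt (px u) p = px (pt u) p :=
    fderiv_apply_comm_of_contDiff hu p (1, 0) (0, 1)
  have hfun : (fun q => pt u q + a q * px u q) = fun q => β q + η q * u q := by
    funext q
    rw [heq q, add_comm]
  have hderiv (v : ℝ × ℝ) := congrArg (fun f => fderiv ℝ f p v) hfun
  simp only [fderiv_add_mul_apply hdt hda hdx, fderiv_add_mul_apply hdβ hdη hdu] at hderiv
  have hx : px (pt u) p + (a p * px (px u) p + px u p * px a p) =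
      px β p + (η p * px u p + u p * px η p) := hderiv (1, 0)
  have ht : pt (pt u) p + (a p * pt (px u) p + px u p * pt a p) =
      pt β p + (η p * pt u p + u p * pt η p) := hderiv (0, 1)
  have hη' : 2 * a p * η p = -(A p - a p * G p + (pt a p - a p * px a p)) := by
    rw [hηdef p, mul_div_cancel₀ _ (mul_ne_zero two_ne_zero (hane p))]
  rw [hmixed] at ht
  linear_combination ht - a p * hx + u p * hstruct p + hβeq p - (G p - η p) * heq p
    - px u p * hη'
end
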